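/- Let G = {U₁, …, U_N} be a nonempty finite multiset of d×d unitary matrices forming a unitary 1-design, let E be any linear map on d×d complex matrices, let ρ be a density matrix, let Q be any d×d complex matrix, and let m ≥ 1. Then the average over all N^m sequences k = (k₁,…,k_m) ∈ {1,…,N}^m of the sequence outcomes Q_k = Tr[ Q · U_{k_m} E( ⋯ U_{k₁} E(ρ) U_{k₁}* ⋯ ) U_{k_m}* ] equals (Tr Q / d) · Tr E(ρ) · (Tr E(I)/d)^{m−1}. -/

import Mathlib

open ComplexOrder Matrix

/-- The state obtained from `ρ` by applying `m` rounds of the noise map `E`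
followed by the unitary `U (k j)` (acting by conjugation), for the random
sequence `k = (k₁, …, k_m)`. -/
noncomputable def seqState {d N : ℕ} (U : Fin N → Matrix (Fin d) (Fin d) ℂ)
    (E : Matrix (Fin d) (Fin d) ℂ →ₗ[ℂ] Matrix (Fin d) (Fin d) ℂ)
    (ρ : Matrix (Fin d) (Fin d) ℂ) :
    (m : ℕ) → (Fin m → Fin N) → Matrix (Fin d) (Fin d) ℂ
  | 0, _ => ρ
  | m + 1, k =>
      U (k (Fin.last m)) * E (seqState U E ρ m (k ∘ Fin.castSucc)) *
        (U (k (Fin.last m)))ᴴ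

/-- Averaging one more round over a unitary 1-design yields a multiple of the identity. -/
theorem average_seqState_succ {d N : ℕ} {U : Fin N → Matrix (Fin d) (Fin d) ℂ}
    (hdesign : ∀ A : Matrix (Fin d) (Fin d) ℂ,
      ((N : ℂ))⁻¹ • ∑ j, U j * A * (U j)ᴴ = (A.trace / d) • (1 : Matrix (Fin d) (Fin d) ℂ))
    (E : Matrix (Fin d) (Fin d) ℂ →ₗ[ℂ] Matrix (Fin d) (Fin d) ℂ)
    (ρ : Matrix (Fin d) (Fin d) ℂ) (m : ℕ) :
    ((N : ℂ) ^ (m + 1))⁻¹ • ∑ k : Fin (m + 1) → Fin N, seqState U E ρ (m + 1) k =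
      ((E (((N : ℂ) ^ m)⁻¹ • ∑ k : Fin m → Fin N, seqState U E ρ m k)).trace / d) •
        (1 : Matrix (Fin d) (Fin d) ℂ) := by
  have hsum : ∑ k : Fin (m + 1) → Fin N, seqState U E ρ (m + 1) k =
      ∑ j, U j * E (∑ k : Fin m → Fin N, seqState U E ρ m k) * (U j)ᴴ := by
    rw [← (Fin.snocEquiv fun _ : Fin (m + 1) ↦ Fin N).sum_comp, Fintype.sum_prod_type]
    refine Finset.sum_congr rfl fun j _ ↦ ?_
    rw [map_sum, Finset.mul_sum, Finset.sum_mul]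
    refine Finset.sum_congr rfl fun k _ ↦ ?_
    have hk : (Fin.snoc k j : Fin (m + 1) → Fin N) ∘ Fin.castSucc = k := by
      ext i; simp
    simp [seqState, Fin.snocEquiv, hk]
  rw [← hdesign, hsum, map_smul]
  simp only [Matrix.mul_smul, Matrix.smul_mul, ← Finset.smul_sum, smul_smul]
  rw [pow_succ', mul_inv]

/-- Closed form of the average state after `m + 1` rounds of noise and random unitaries drawn
from a unitary 1-design. -/
theorem average_seqState_succ_eq {d N : ℕ} {U : Fin N → Matrix (Fin d) (Fin d) ℂ}
    (hdesign : ∀ A : Matrix (Fin d) (Fin d) ℂ,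
      ((N : ℂ))⁻¹ • ∑ j, U j * A * (U j)ᴴ = (A.trace / d) • (1 : Matrix (Fin d) (Fin d) ℂ))
    (E : Matrix (Fin d) (Fin d) ℂ →ₗ[ℂ] Matrix (Fin d) (Fin d) ℂ)
    (ρ : Matrix (Fin d) (Fin d) ℂ) (m : ℕ) :
    ((N : ℂ) ^ (m + 1))⁻¹ • ∑ k : Fin (m + 1) → Fin N, seqState U E ρ (m + 1) k =
      ((E ρ).trace / d * ((E 1).trace / d) ^ m) • (1 : Matrix (Fin d) (Fin d) ℂ) := by
  induction m with
  | zero =>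
    rw [average_seqState_succ hdesign]
    simp [seqState]
  | succ m ih =>
    rw [average_seqState_succ hdesign, ih, map_smul, Matrix.trace_smul, smul_eq_mul]
    congr 1
    ring

/-- If the unitaries `U₁, …, U_N` form a unitary 1-design, then for
any linear map `E`, density matrix `ρ`, matrix `Q` and `m ≥ 1`, the average over all
`N^m` random sequences of the outcomes
`Q_k = Tr[Q · U_{k_m} E(⋯ U_{k₁} E(ρ) U_{k₁}* ⋯) U_{k_m}*]` equals
`(Tr Q / d) · Tr E(ρ) · (Tr E(I)/d)^{m−1}`. -/
theorem average_sequence_outcome_of_unitary_one_design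
    (d N : ℕ) (hd : 1 ≤ d) (hN : 1 ≤ N)
    (U : Fin N → Matrix (Fin d) (Fin d) ℂ)
    (hU : ∀ j, U j ∈ Matrix.unitaryGroup (Fin d) ℂ)
    (hdesign : ∀ A : Matrix (Fin d) (Fin d) ℂ,
      ((N : ℂ))⁻¹ • ∑ j, U j * A * (U j)ᴴ = (A.trace / d) • (1 : Matrix (Fin d) (Fin d) ℂ))
    (E : Matrix (Fin d) (Fin d) ℂ →ₗ[ℂ] Matrix (Fin d) (Fin d) ℂ)
    (ρ : Matrix (Fin d) (Fin d) ℂ) (hρ : ρ.PosSemidef) (hρtr : ρ.trace = 1)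
    (Q : Matrix (Fin d) (Fin d) ℂ) (m : ℕ) (hm : 1 ≤ m) :
    ((N : ℂ) ^ m)⁻¹ * ∑ k : Fin m → Fin N, (Q * seqState U E ρ m k).trace =
      (Q.trace / d) * (E ρ).trace * ((E 1).trace / d) ^ (m - 1) := by
  obtain ⟨m, rfl⟩ := Nat.exists_eq_add_of_le' hm
  rw [← Matrix.trace_sum, ← Finset.mul_sum, ← smul_eq_mul, ← Matrix.trace_smul,
    ← Matrix.mul_smul, average_seqState_succ_eq hdesign, Matrix.mul_smul, mul_one,
    Matrix.trace_smul, smul_eq_mul, Nat.add_sub_cancel]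
  ring
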